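/- arXiv:1804.07512 — 3 statements merged into one kernel-verified Lean document; each statement's English description precedes it below -/
import Mathlib

section
/- Let r ≥ 1 be an integer, α, β > r−1 real, and n ≥ 0 an integer. Then the following polynomial identity holds for all real x: (β(1−x^r) − αr x^r) p_n(x; α, β) + x(1−x^r) p_n'(x; α, β) = ∑_{k=1}^{r} a_{k,n}^{(α,β)} x^{r−k} p_{n+k}(x; α−k, β−k), where a_{k,n}^{(α,β)} = (−1)^k [ C(r,k)(rα+β) + C(r+1,k+1) k n ]. Equivalently, for 0 < x < 1, d/dx [ x^β (1−x^r)^α p_n(x; α, β) ] = x^{β−1}(1−x^r)^{α−1} ∑_{k=1}^{r} a_{k,n}^{(α,β)} x^{r−k} p_{n+k}(x; α−k, β−k). -/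
/-- The polynomial p_n(x; α, β) on the r-star. -/
noncomputable def jacAng (r n : ℕ) (α β x : ℝ) : ℝ :=
  ∑ k ∈ Finset.range (n + 1), (n.choose k : ℝ) *
    (Real.Gamma (n + α + (β + k) / r + 1) /
      (Real.Gamma (n + α + 1) * Real.Gamma ((β + k) / r + 1))) *
    (-1) ^ (n - k) * x ^ k

/-- The coefficients a_{k,n}^{(α,β)} = (−1)^k [C(r,k)(rα+β) + C(r+1,k+1) k n]. -/
noncomputable def raisCoeff (r k n : ℕ) (α β : ℝ) : ℝ :=
  (-1) ^ k * ((r.choose k : ℝ) * (r * α + β) + ((r + 1).choose (k + 1) : ℝ) * k * n)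

/-- Splitting an alternating binomial sum of order `r + 1` by Pascal's rule. -/
lemma sum_alternating_choose_succ (f : ℕ → ℝ) (r : ℕ) :
    ∑ k ∈ Finset.range (r + 2), (-1 : ℝ) ^ k * ((r + 1).choose k : ℝ) * f k
      = ∑ k ∈ Finset.range (r + 1), (-1 : ℝ) ^ k * (r.choose k : ℝ) * f k
        - ∑ k ∈ Finset.range (r + 1), (-1 : ℝ) ^ k * (r.choose k : ℝ) * f (k + 1) := by
  have h : ∑ k ∈ Finset.range (r + 1), (-1 : ℝ) ^ k * (r.choose k : ℝ) * f k
      = ∑ k ∈ Finset.range (r + 1), (-1 : ℝ) ^ (k + 1) * (r.choose (k + 1) : ℝ) * f (k + 1)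
        + f 0 := by
    have h₁ := Finset.sum_range_succ' (fun k => (-1 : ℝ) ^ k * (r.choose k : ℝ) * f k) (r + 1)
    rw [Finset.sum_range_succ] at h₁
    simpa using h₁
  rw [h, Finset.sum_range_succ', add_sub_right_comm, ← Finset.sum_sub_distrib]
  simp only [Nat.choose_succ_succ, pow_succ, Nat.cast_add, pow_zero, Nat.choose_zero_right,
    Nat.cast_one, one_mul]
  congr 1
  exact Finset.sum_congr rfl fun k _ => by ring

/-- The `r`-th finite difference of a binomial coefficient in its upper entry. -/
lemma sum_alternating_choose_mul_choose (r t : ℕ) : ∀ n : ℕ,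
    ∑ k ∈ Finset.range (r + 1), (-1 : ℝ) ^ k * (r.choose k : ℝ) * ((n + k).choose t : ℝ)
      = (-1) ^ r * if r ≤ t then (n.choose (t - r) : ℝ) else 0 := by
  induction r with
  | zero => intro n; simp
  | succ r ih =>
    intro n
    rw [sum_alternating_choose_succ (fun k => ((n + k).choose t : ℝ)), ih n]
    have h := ih (n + 1)
    simp only [add_right_comm n 1] at h
    simp only [← add_assoc]
    rw [h]
    rcases lt_trichotomy t r with htr | rfl | htr
    · rw [if_neg (by omega), if_neg (by omega), if_neg (by omega)]; simp
    · rw [if_pos le_rfl, if_pos le_rfl, if_neg (by omega)]; simp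
    · obtain ⟨d, rfl⟩ := Nat.exists_eq_add_of_lt htr
      rw [if_pos (by omega), if_pos (by omega), if_pos (by omega)]
      rw [show r + d + 1 - r = d + 1 by omega, show r + d + 1 - (r + 1) = d by omega,
        Nat.choose_succ_succ]
      push_cast
      ring

lemma sum_alternating_choose_mul_choose_sub (r n m : ℕ) (hm : m ≤ n + r) :
    ∑ k ∈ Finset.range (r + 1),
        (-1 : ℝ) ^ k * (r.choose k : ℝ) * ((n + k).choose (n + r - m) : ℝ)
      = (-1) ^ r * (n.choose m : ℝ) := by
  rw [sum_alternating_choose_mul_choose]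
  split_ifs with h
  · rw [show n + r - m - r = n - m by omega, Nat.choose_symm (by omega)]
  · rw [Nat.choose_eq_zero_of_lt (by omega)]; simp

/-- Version with the shifted weights `C(r+1, k+1) k`, multiplied by `n`. -/
lemma sum_alternating_succ_choose_mul_choose_sub (r n m : ℕ) (hm : m ≤ n + r) :
    (n : ℝ) * ∑ k ∈ Finset.range (r + 1), (-1 : ℝ) ^ k * (((r + 1).choose (k + 1) : ℝ) * k)
        * ((n + k).choose (n + r - m) : ℝ)
      = (-1) ^ r * (r * n + m) * (n.choose m : ℝ) - (m - r) * (n.choose (n + r - m) : ℝ) := by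
  rcases n with _ | n
  · rcases Nat.eq_zero_or_pos m with rfl | hpos
    · rcases Nat.eq_zero_or_pos r with rfl | hr
      · simp
      · simp [Nat.choose_eq_zero_of_lt hr]
    · rcases eq_or_lt_of_le hm with rfl | hlt
      · rw [zero_add] at hpos ⊢
        simp [Nat.choose_eq_zero_of_lt hpos]
      · rw [Nat.choose_eq_zero_of_lt hpos, Nat.choose_eq_zero_of_lt (by omega)]; simp
  · have hw : ∀ k : ℕ, ((r + 1).choose (k + 1) : ℝ) * k
        = (r + 1) * (r.choose k : ℝ) - ((r + 1).choose (k + 1) : ℝ) := fun k => by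
      have h : ((r + 1 : ℕ) : ℝ) * (r.choose k : ℝ)
          = ((r + 1).choose (k + 1) : ℝ) * ((k + 1 : ℕ) : ℝ) := by
        exact_mod_cast Nat.add_one_mul_choose_eq r k
      push_cast at h
      linarith
    have h₁ := sum_alternating_choose_mul_choose_sub r (n + 1) m hm
    have h₂ := sum_alternating_choose_mul_choose_sub (r + 1) n m (by omega)
    rw [Finset.sum_range_succ'] at h₂
    rw [show n + (r + 1) - m = n + 1 + r - m by omega] at h₂
    have h₃ : ∑ k ∈ Finset.range (r + 1), (-1 : ℝ) ^ k * (((r + 1).choose (k + 1) : ℝ) * k)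
          * ((n + 1 + k).choose (n + 1 + r - m) : ℝ)
        = (r + 1) * ∑ k ∈ Finset.range (r + 1),
            (-1 : ℝ) ^ k * (r.choose k : ℝ) * ((n + 1 + k).choose (n + 1 + r - m) : ℝ)
          + ∑ k ∈ Finset.range (r + 1), (-1 : ℝ) ^ (k + 1) * ((r + 1).choose (k + 1) : ℝ)
            * ((n + (k + 1)).choose (n + 1 + r - m) : ℝ) := by
      rw [Finset.mul_sum, ← Finset.sum_add_distrib]
      refine Finset.sum_congr rfl fun k _ => ?_
      rw [hw, show n + (k + 1) = n + 1 + k by omega]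
      ring
    have h₄ : ((n : ℝ) + 1) * (n.choose m : ℝ) = (n + 1 - m) * ((n + 1).choose m : ℝ) := by
      rcases Nat.lt_or_ge (n + 1) m with h | h
      · rw [Nat.choose_eq_zero_of_lt h, Nat.choose_eq_zero_of_lt (by omega)]; simp
      · have := Nat.choose_mul_succ_eq n m
        have h' : (n.choose m : ℝ) * (n + 1) = ((n + 1).choose m : ℝ) * ((n + 1 - m : ℕ) : ℝ) := by
          exact_mod_cast this
        rw [Nat.cast_sub h] at h'
        push_cast at h'
        linarith
    have h₅ : ((n : ℝ) + 1) * (n.choose (n + 1 + r - m) : ℝ)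
        = (m - r) * ((n + 1).choose (n + 1 + r - m) : ℝ) := by
      rcases Nat.lt_or_ge m r with h | h
      · rw [Nat.choose_eq_zero_of_lt (by omega : n < _),
          Nat.choose_eq_zero_of_lt (by omega : n + 1 < _)]; simp
      · have := Nat.choose_mul_succ_eq n (n + 1 + r - m)
        rw [show n + 1 - (n + 1 + r - m) = m - r by omega] at this
        have h' : (n.choose (n + 1 + r - m) : ℝ) * (n + 1)
            = ((n + 1).choose (n + 1 + r - m) : ℝ) * ((m - r : ℕ) : ℝ) := by
          exact_mod_cast this
        rw [Nat.cast_sub h] at h'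
        linarith
    rw [h₃, h₁]
    simp only [pow_zero, Nat.choose_zero_right, Nat.cast_one, one_mul, add_zero] at h₂
    rw [eq_sub_of_add_eq h₂]
    push_cast
    rw [mul_add, mul_sub, h₅]
    rw [pow_succ]
    linear_combination (-(-1 : ℝ) ^ r) * h₄

/-- Reindexing of a binomial sum multiplied by a shifted sequence. -/
lemma sum_choose_mul_shift (f : ℕ → ℝ) (r n k : ℕ) (hk : k ≤ r) :
    ∑ j ∈ Finset.range (n + k + 1), ((n + k).choose j : ℝ) * f (r - k + j)
      = ∑ m ∈ Finset.range (n + r + 1), ((n + k).choose (n + r - m) : ℝ) * f m := by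
  rw [show n + r + 1 = (r - k) + (n + k + 1) by omega, Finset.sum_range_add _ (r - k),
    Finset.sum_eq_zero (s := Finset.range (r - k)), zero_add]
  · refine Finset.sum_congr rfl fun j hj => ?_
    rw [Finset.mem_range] at hj
    rw [show n + r - (r - k + j) = n + k - j by omega, Nat.choose_symm (by omega)]
  · intro m hm
    rw [Finset.mem_range] at hm
    rw [Nat.choose_eq_zero_of_lt (by omega)]; simp

/-- The common factor of the coefficients of `x ^ m` on both sides of the raising identity. -/
noncomputable def raisWeight (r n : ℕ) (α β x : ℝ) (m : ℕ) : ℝ :=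
  Real.Gamma (n + α + (β + m) / r) / (Real.Gamma (n + α + 1) * Real.Gamma ((β + m) / r))
    * (-1) ^ (n + r + m) * x ^ m

/-- The general term of `jacAng r (n + k) (α - k) (β - k)`, shifted by `x ^ (r - k)`. -/
lemma jacAng_term_shift (r n k j : ℕ) (α β x : ℝ) (hr : 1 ≤ r) (hk : k ≤ r)
    (hj : j ≤ n + k) :
    x ^ (r - k) * ((Real.Gamma ((n + k : ℕ) + (α - k) + (β - k + j) / r + 1) /
      (Real.Gamma ((n + k : ℕ) + (α - k) + 1) * Real.Gamma ((β - k + j) / r + 1))) *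
      (-1) ^ (n + k - j) * x ^ j) = raisWeight r n α β x (r - k + j) := by
  have hr0 : (r : ℝ) ≠ 0 := by positivity
  have hs : (β + (r - k + j : ℕ)) / r = (β - k + j) / r + 1 := by
    push_cast [Nat.cast_sub hk]
    field_simp
    ring
  have hp : (-1 : ℝ) ^ (n + r + (r - k + j)) = (-1) ^ (n + k - j) := by
    obtain ⟨d, rfl⟩ := Nat.exists_eq_add_of_le hk
    obtain ⟨e, he⟩ := Nat.exists_eq_add_of_le hj
    rw [show n + k - j = e by omega,
      show n + (k + d) + (k + d - k + j) = e + 2 * (j + d) by omega, pow_add, pow_mul]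
    simp
  rw [raisWeight, hs, hp, pow_add]
  push_cast
  rw [show (n : ℝ) + k + (α - k) = n + α by ring, ← add_assoc]
  ring

lemma pow_mul_jacAng (r n k : ℕ) (α β x : ℝ) (hr : 1 ≤ r) (hk : k ≤ r) :
    x ^ (r - k) * jacAng r (n + k) (α - k) (β - k) x
      = ∑ m ∈ Finset.range (n + r + 1),
          ((n + k).choose (n + r - m) : ℝ) * raisWeight r n α β x m := by
  rw [← sum_choose_mul_shift _ r n k hk, jacAng, Finset.mul_sum]
  refine Finset.sum_congr rfl fun j hj => ?_
  rw [Finset.mem_range] at hj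
  rw [← jacAng_term_shift r n k j α β x hr hk (by omega)]
  ring

lemma hasDerivAt_jacAng (r n : ℕ) (α β x : ℝ) :
    HasDerivAt (jacAng r n α β) (∑ k ∈ Finset.range (n + 1), (n.choose k : ℝ) *
      (Real.Gamma (n + α + (β + k) / r + 1) /
        (Real.Gamma (n + α + 1) * Real.Gamma ((β + k) / r + 1))) *
      (-1) ^ (n - k) * (k * x ^ (k - 1))) x := by
  unfold jacAng
  exact HasDerivAt.fun_sum fun k _ => (hasDerivAt_pow k x).const_mul _

lemma mul_deriv_jacAng (r n : ℕ) (α β x : ℝ) :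
    x * deriv (jacAng r n α β) x = ∑ k ∈ Finset.range (n + 1), k * ((n.choose k : ℝ) *
      (Real.Gamma (n + α + (β + k) / r + 1) /
        (Real.Gamma (n + α + 1) * Real.Gamma ((β + k) / r + 1))) *
      (-1) ^ (n - k) * x ^ k) := by
  rw [(hasDerivAt_jacAng r n α β x).deriv, Finset.mul_sum]
  refine Finset.sum_congr rfl fun k _ => ?_
  rcases k with _ | k
  · simp
  · rw [Nat.add_sub_cancel, pow_succ]; ring

lemma pow_mul_add_deriv_jacAng (r n : ℕ) (α β c x : ℝ) (hr : 1 ≤ r) :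
    x ^ r * (c * jacAng r n α β x + x * deriv (jacAng r n α β) x)
      = ∑ m ∈ Finset.range (n + r + 1),
          (n.choose (n + r - m) : ℝ) * ((c + m - r) * raisWeight r n α β x m) := by
  have h := sum_choose_mul_shift (fun m => (c + m - r) * raisWeight r n α β x m) r n 0
    (Nat.zero_le r)
  simp only [add_zero] at h
  rw [← h, mul_deriv_jacAng, jacAng, Finset.mul_sum, ← Finset.sum_add_distrib, Finset.mul_sum]
  refine Finset.sum_congr rfl fun j hj => ?_
  rw [Finset.mem_range] at hj
  rw [← jacAng_term_shift r n 0 j α β x hr (Nat.zero_le r) (by omega)]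
  simp only [Nat.sub_zero, add_zero, Nat.cast_zero, sub_zero]
  push_cast
  ring

lemma add_deriv_jacAng (r n : ℕ) (α β x : ℝ) (hr : 1 ≤ r) (hα : 0 < α) (hβ : 0 < β) :
    β * jacAng r n α β x + x * deriv (jacAng r n α β) x
      = ∑ m ∈ Finset.range (n + r + 1),
          (-1) ^ r * (r * n + (r * α + β) + m) * (n.choose m : ℝ) * raisWeight r n α β x m := by
  rw [mul_deriv_jacAng, jacAng, Finset.mul_sum, ← Finset.sum_add_distrib]
  have hsub : Finset.range (n + 1) ⊆ Finset.range (n + r + 1) :=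
    Finset.range_mono (by omega)
  rw [← Finset.sum_subset hsub]
  · refine Finset.sum_congr rfl fun m hm => ?_
    rw [Finset.mem_range] at hm
    have hr0 : (0 : ℝ) < r := by exact_mod_cast hr
    have hs : 0 < (β + m) / r := by positivity
    have hN : 0 < n + α + (β + m) / r := by positivity
    have hp : (-1 : ℝ) ^ (n + r + m) = (-1) ^ r * (-1) ^ (n - m) := by
      rw [← pow_add, show n + r + m = r + (n - m) + 2 * m by omega, pow_add _ _ (2 * m), pow_mul]
      simp
    have hq : (-1 : ℝ) ^ r * (-1) ^ r = 1 := by rw [← mul_pow]; simp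
    rw [raisWeight, hp, Real.Gamma_add_one hs.ne', Real.Gamma_add_one hN.ne']
    have hG : Real.Gamma ((β + m) / r) ≠ 0 := (Real.Gamma_pos_of_pos hs).ne'
    have hG' : Real.Gamma (n + α + 1) ≠ 0 := (Real.Gamma_pos_of_pos (by positivity)).ne'
    have hm0 : β + m ≠ 0 := by positivity
    have hc : (r * n + (r * α + β) + m : ℝ) = r * (n + α + (β + m) / r) := by
      field_simp
      ring
    rw [hc]
    generalize Real.Gamma (n + α + (β + m) / r) = A
    generalize Real.Gamma ((β + m) / r) = B at *
    generalize Real.Gamma (n + α + 1) = C at *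
    generalize n + α + (β + m) / r = N at *
    generalize (-1 : ℝ) ^ (n - m) = e
    generalize (-1 : ℝ) ^ r = e' at *
    field_simp
    linear_combination (-((n.choose m : ℝ) * A * e * x ^ m)) * hq
  · intro m _ hm
    rw [Finset.mem_range, not_lt] at hm
    rw [Nat.choose_eq_zero_of_lt (by omega)]; simp

lemma sum_raisCoeff_mul_choose (r n m : ℕ) (α β : ℝ) (hm : m ≤ n + r) :
    ∑ k ∈ Finset.Icc 1 r, raisCoeff r k n α β * ((n + k).choose (n + r - m) : ℝ)
      = (-1) ^ r * (r * n + (r * α + β) + m) * (n.choose m : ℝ)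
        - (r * α + β + m - r) * (n.choose (n + r - m) : ℝ) := by
  have h₀ : ∑ k ∈ Finset.range (r + 1), raisCoeff r k n α β * ((n + k).choose (n + r - m) : ℝ)
      = (r * α + β) * (n.choose (n + r - m) : ℝ)
        + ∑ k ∈ Finset.Icc 1 r, raisCoeff r k n α β * ((n + k).choose (n + r - m) : ℝ) := by
    rw [Finset.range_eq_Ico, Finset.sum_eq_sum_Ico_succ_bot (by omega),
      ← Finset.Ico_add_one_right_eq_Icc]
    simp [raisCoeff]
  have h₁ : ∑ k ∈ Finset.range (r + 1), raisCoeff r k n α β * ((n + k).choose (n + r - m) : ℝ)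
      = (r * α + β) * ∑ k ∈ Finset.range (r + 1),
          (-1 : ℝ) ^ k * (r.choose k : ℝ) * ((n + k).choose (n + r - m) : ℝ)
        + n * ∑ k ∈ Finset.range (r + 1), (-1 : ℝ) ^ k * (((r + 1).choose (k + 1) : ℝ) * k)
          * ((n + k).choose (n + r - m) : ℝ) := by
    rw [Finset.mul_sum, Finset.mul_sum, ← Finset.sum_add_distrib]
    refine Finset.sum_congr rfl fun k _ => ?_
    rw [raisCoeff]
    ring
  rw [sum_alternating_choose_mul_choose_sub r n m hm,
    sum_alternating_succ_choose_mul_choose_sub r n m hm] at h₁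
  linear_combination h₁ - h₀

/-- The polynomial form of the raising identity. -/
lemma jacAng_raising_polynomial (r n : ℕ) (α β x : ℝ) (hr : 1 ≤ r) (hα : 0 < α) (hβ : 0 < β) :
    (β * (1 - x ^ r) - α * r * x ^ r) * jacAng r n α β x
        + x * (1 - x ^ r) * deriv (jacAng r n α β) x
      = ∑ k ∈ Finset.Icc 1 r,
          raisCoeff r k n α β * x ^ (r - k) * jacAng r (n + k) (α - k) (β - k) x := by
  have hR : ∑ k ∈ Finset.Icc 1 r,
          raisCoeff r k n α β * x ^ (r - k) * jacAng r (n + k) (α - k) (β - k) x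
      = ∑ m ∈ Finset.range (n + r + 1),
          (∑ k ∈ Finset.Icc 1 r, raisCoeff r k n α β * ((n + k).choose (n + r - m) : ℝ))
            * raisWeight r n α β x m := by
    simp only [Finset.sum_mul]
    rw [Finset.sum_comm]
    refine Finset.sum_congr rfl fun k hk => ?_
    rw [mul_assoc, pow_mul_jacAng r n k α β x hr (Finset.mem_Icc.1 hk).2, Finset.mul_sum]
    exact Finset.sum_congr rfl fun m _ => (mul_assoc _ _ _).symm
  have hA := add_deriv_jacAng r n α β x hr hα hβ
  have hB := pow_mul_add_deriv_jacAng r n α β (r * α + β) x hr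
  calc _ = (β * jacAng r n α β x + x * deriv (jacAng r n α β) x)
        - x ^ r * ((r * α + β) * jacAng r n α β x + x * deriv (jacAng r n α β) x) := by ring
    _ = _ := by
      rw [hA, hB, hR, ← Finset.sum_sub_distrib]
      refine Finset.sum_congr rfl fun m hm => ?_
      rw [Finset.mem_range] at hm
      rw [sum_raisCoeff_mul_choose r n m α β (by omega)]
      ring

/-- the raising identity for p_n(x; α, β) on the r-star:
(β(1−x^r) − αr x^r) p_n(x;α,β) + x(1−x^r) p_n'(x;α,β)
  = ∑_{k=1}^r a_{k,n}^{(α,β)} x^{r−k} p_{n+k}(x;α−k,β−k),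
and, equivalently, on (0,1),
d/dx [x^β (1−x^r)^α p_n(x;α,β)]
  = x^{β−1}(1−x^r)^{α−1} ∑_{k=1}^r a_{k,n}^{(α,β)} x^{r−k} p_{n+k}(x;α−k,β−k). -/
theorem jacAng_raising_rstar
    (r : ℕ) (hr : 1 ≤ r) (α β : ℝ) (hα : (r : ℝ) - 1 < α) (hβ : (r : ℝ) - 1 < β) (n : ℕ) :
    (∀ x : ℝ,
      (β * (1 - x ^ r) - α * r * x ^ r) * jacAng r n α β x
        + x * (1 - x ^ r) * deriv (jacAng r n α β) x
      = ∑ k ∈ Finset.Icc 1 r,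
          raisCoeff r k n α β * x ^ (r - k) * jacAng r (n + k) (α - k) (β - k) x) ∧
    (∀ x ∈ Set.Ioo (0:ℝ) 1,
      HasDerivAt (fun y : ℝ => y ^ β * (1 - y ^ r) ^ α * jacAng r n α β y)
        (x ^ (β - 1) * (1 - x ^ r) ^ (α - 1) *
          ∑ k ∈ Finset.Icc 1 r,
            raisCoeff r k n α β * x ^ (r - k) * jacAng r (n + k) (α - k) (β - k) x) x) := by
  have hr' : (1 : ℝ) ≤ r := by exact_mod_cast hr
  have hpoly := fun x : ℝ =>
    jacAng_raising_polynomial r n α β x hr (by linarith) (by linarith)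
  refine ⟨hpoly, fun x hx => ?_⟩
  have hx0 : 0 < x := hx.1
  have hx1 : 0 < 1 - x ^ r := sub_pos.2 (pow_lt_one₀ hx0.le hx.2 (by omega))
  have hd := (((Real.hasDerivAt_rpow_const (p := β) (Or.inl hx0.ne')).mul
    (((hasDerivAt_pow r x).const_sub 1).rpow_const (p := α) (Or.inl hx1.ne'))).mul
    (hasDerivAt_jacAng r n α β x).differentiableAt.hasDerivAt)
  refine hd.congr_deriv ?_
  rw [← hpoly x]
  have h₁ : x ^ β = x ^ (β - 1) * x := by
    rw [Real.rpow_sub_one hx0.ne', div_mul_cancel₀ _ hx0.ne']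
  have h₂ : (1 - x ^ r) ^ α = (1 - x ^ r) ^ (α - 1) * (1 - x ^ r) := by
    rw [Real.rpow_sub_one hx1.ne', div_mul_cancel₀ _ hx1.ne']
  have h₃ : x ^ r = x ^ (r - 1) * x := by rw [← pow_succ, Nat.sub_add_cancel hr]
  simp only [Pi.mul_apply]
  rw [h₁, h₂]
  generalize x ^ (β - 1) = A
  generalize (1 - x ^ r) ^ (α - 1) = B
  rw [h₃]
  ring
end

section
/- Let r ≥ 1 be an integer, α, β > −1 real, and n ≥ 0 an integer. Then the polynomial y(x) = p_n(x; α, β) satisfies the linear differential equation of order r+1: x(1−x^r) y^{(r+1)}(x) + (r+β) y^{(r)}(x) + ∑_{k=0}^{r} c_{k,n}^{(α,β)} x^k y^{(k)}(x) = 0 for all real x, where c_{k,n}^{(α,β)} = (−1)^{r+k+1} (n−r+1)_{r−k} [ C(r,k)(rα+β) + C(r+1,k)(rn+r−kn) ] and (a)_m denotes the Pochhammer symbol a(a+1)⋯(a+m−1). -/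
/-- The coefficients c_{k,n}^{(α,β)} = (−1)^{r+k+1} (n−r+1)_{r−k}
[C(r,k)(rα+β) + C(r+1,k)(rn+r−kn)], where (a)_m = a(a+1)⋯(a+m−1). -/
noncomputable def odeCoeff (r k n : ℕ) (α β : ℝ) : ℝ :=
  (-1) ^ (r + k + 1) * (∏ i ∈ Finset.range (r - k), ((n : ℝ) - r + 1 + i)) *
    ((r.choose k : ℝ) * (r * α + β) + ((r + 1).choose k : ℝ) * ((r : ℝ) * n + r - k * n))

/-- The Chu–Vandermonde identity for rising factorials. -/
lemma sum_choose_mul_prod_add (a b : ℝ) (r : ℕ) :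
    ∑ k ∈ Finset.range (r + 1), (r.choose k : ℝ) *
      ((∏ i ∈ Finset.range k, (b + i)) * ∏ i ∈ Finset.range (r - k), (a + i)) =
      ∏ i ∈ Finset.range r, (a + b + i) := by
  rw [← Finset.Nat.sum_antidiagonal_eq_sum_range_succ (fun k l ↦ (r.choose k : ℝ) *
      ((∏ i ∈ Finset.range k, (b + i)) * ∏ i ∈ Finset.range l, (a + i)))]
  induction r with
  | zero => simp
  | succ r ih =>
    rw [Finset.sum_antidiagonal_choose_succ_mul (fun k l ↦
        (∏ i ∈ Finset.range k, (b + (i : ℝ))) * ∏ i ∈ Finset.range l, (a + (i : ℝ))),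
      ← Finset.sum_add_distrib, Finset.prod_range_succ, ← ih, Finset.sum_mul]
    refine Finset.sum_congr rfl fun p hp ↦ ?_
    rw [Finset.HasAntidiagonal.mem_antidiagonal] at hp
    rw [Nat.choose_symm_of_eq_add hp.symm, Finset.prod_range_succ, Finset.prod_range_succ,
      ← hp, Nat.cast_add]
    ring

lemma prod_neg_add_eq (x : ℝ) (m : ℕ) :
    ∏ i ∈ Finset.range m, (-x + i) = (-1) ^ m * ∏ i ∈ Finset.range m, (x - i) := by
  induction m with
  | zero => simp
  | succ m ih => rw [Finset.prod_range_succ, Finset.prod_range_succ, ih]; ring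

lemma prod_shift_eq (x : ℝ) (m : ℕ) :
    ∏ i ∈ Finset.range m, (x - m + 1 + i) = ∏ i ∈ Finset.range m, (x - i) := by
  rw [← Finset.prod_range_reflect]
  refine Finset.prod_congr rfl fun i hi ↦ ?_
  rw [Finset.mem_range] at hi
  rw [Nat.sub_sub, Nat.cast_sub (by omega)]
  push_cast
  ring

lemma cast_descFactorial_eq_prod (j k : ℕ) :
    (j.descFactorial k : ℝ) = ∏ i ∈ Finset.range k, ((j : ℝ) - i) := by
  rw [← descPochhammer_eval_eq_descFactorial, descPochhammer_eval_eq_prod_range]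

lemma sum_choose_mul_prod_mul_descending (x y : ℝ) (r : ℕ) :
    ∑ k ∈ Finset.range (r + 1), (-1) ^ k * (r.choose k : ℝ) *
      (∏ i ∈ Finset.range (r - k), (x - r + 1 + i)) * ∏ i ∈ Finset.range k, (y - i) =
      ∏ i ∈ Finset.range r, (x - y - i) := by
  rw [← prod_shift_eq, show x - y - r + 1 = (x - r + 1) + -y by ring,
    ← sum_choose_mul_prod_add]
  refine Finset.sum_congr rfl fun k _ ↦ ?_
  rw [prod_neg_add_eq]
  ring

/-- The eigenvalue on `x ^ j` of the degree-preserving part of the differential operator. -/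
lemma sum_odeCoeff_mul_descFactorial (r n j : ℕ) (hj : j ≤ n) (α β : ℝ) :
    ∑ k ∈ Finset.range (r + 1), odeCoeff r k n α β * (j.descFactorial k : ℝ)
      - (j.descFactorial (r + 1) : ℝ) =
      (-1) ^ (r + 1) * ((n - j).descFactorial r : ℝ) * (r * α + β + r * n + r + j) := by
  have h₁ := sum_choose_mul_prod_mul_descending (n : ℝ) j r
  have h₂ := sum_choose_mul_prod_mul_descending (n : ℝ) j (r + 1)
  have hD := Finset.prod_range_succ (fun i ↦ (n : ℝ) - j - i) r
  rw [Finset.sum_range_succ, hD] at h₂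
  have key : ∀ k ∈ Finset.range (r + 1), odeCoeff r k n α β * (j.descFactorial k : ℝ) =
      (-1) ^ (r + 1) * ((r * α + β + n * (r + 1)) * ((-1) ^ k * (r.choose k : ℝ) *
        (∏ i ∈ Finset.range (r - k), ((n : ℝ) - r + 1 + i)) *
          ∏ i ∈ Finset.range k, ((j : ℝ) - i)) -
        (-1) ^ k * ((r + 1).choose k : ℝ) *
        (∏ i ∈ Finset.range (r + 1 - k), ((n : ℝ) - (r + 1 : ℕ) + 1 + i)) *
          ∏ i ∈ Finset.range k, ((j : ℝ) - i)) := by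
    intro k hk
    have hk' : k ≤ r := Nat.lt_succ_iff.mp (Finset.mem_range.mp hk)
    have hc : ((r + 1).choose k : ℝ) * (r + 1 - k) = r.choose k * (r + 1) := by
      have := Nat.choose_mul_succ_eq r k
      rw [← @Nat.cast_inj ℝ] at this
      push_cast [Nat.cast_sub (show k ≤ r + 1 by omega)] at this
      exact this.symm
    have hp : ∏ i ∈ Finset.range (r + 1 - k), ((n : ℝ) - (r + 1 : ℕ) + 1 + i) =
        (∏ i ∈ Finset.range (r - k), ((n : ℝ) - r + 1 + i)) * (n - r) := by
      rw [Nat.succ_sub hk', Finset.prod_range_succ']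
      congr 1
      · exact Finset.prod_congr rfl fun i _ ↦ by push_cast; ring
      · push_cast; ring
    rw [odeCoeff, cast_descFactorial_eq_prod, hp]
    linear_combination (-1) ^ (r + k + 1) * (∏ i ∈ Finset.range (r - k), ((n : ℝ) - r + 1 + i)) *
      (∏ i ∈ Finset.range k, ((j : ℝ) - i)) * n * hc
  rw [Finset.sum_congr rfl key, ← Finset.mul_sum, Finset.sum_sub_distrib, ← Finset.mul_sum, h₁,
    cast_descFactorial_eq_prod, cast_descFactorial_eq_prod, Nat.cast_sub hj]
  have hs : ((-1 : ℝ) ^ (r + 1)) * (-1) ^ (r + 1) = 1 := by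
    rw [← mul_pow]; norm_num
  simp only [Nat.choose_self, Nat.sub_self, Finset.prod_range_zero, Nat.cast_one, mul_one] at h₂
  linear_combination (-1 : ℝ) * (-1) ^ (r + 1) * h₂ +
    (∏ i ∈ Finset.range (r + 1), ((j : ℝ) - i)) * hs

/-- The coefficient of `x ^ k` in `jacAng r n α β`. -/
noncomputable def jacAngCoeff (r n : ℕ) (α β : ℝ) (k : ℕ) : ℝ :=
  (n.choose k : ℝ) *
    (Real.Gamma (n + α + (β + k) / r + 1) /
      (Real.Gamma (n + α + 1) * Real.Gamma ((β + k) / r + 1))) *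
    (-1) ^ (n - k)

lemma iteratedDeriv_jacAng (r n : ℕ) (α β x : ℝ) (m : ℕ) :
    iteratedDeriv m (jacAng r n α β) x = ∑ j ∈ Finset.range (n + 1),
      jacAngCoeff r n α β j * (j.descFactorial m * x ^ (j - m)) := by
  have h : jacAng r n α β =
      fun x ↦ ∑ j ∈ Finset.range (n + 1), jacAngCoeff r n α β j * x ^ j := rfl
  rw [h, iteratedDeriv_fun_sum fun i _ ↦ by fun_prop]
  refine Finset.sum_congr rfl fun j _ ↦ ?_
  rw [iteratedDeriv_const_mul_field, iteratedDeriv_pow]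

lemma jacAngCoeff_eq_zero {r n k : ℕ} (α β : ℝ) (h : n < k) : jacAngCoeff r n α β k = 0 := by
  simp [jacAngCoeff, Nat.choose_eq_zero_of_lt h]

lemma choose_add_mul_descFactorial (n j r : ℕ) :
    n.choose (j + r) * (j + r).descFactorial r = n.choose j * (n - j).descFactorial r := by
  have h := Nat.choose_mul (n := n) (Nat.le_add_right j r)
  rw [Nat.add_sub_cancel_left, Nat.choose_symm_add] at h
  rw [Nat.descFactorial_eq_factorial_mul_choose, Nat.descFactorial_eq_factorial_mul_choose,
    mul_left_comm, h, mul_left_comm]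

lemma jacAngCoeff_add (r n j : ℕ) (hr : 1 ≤ r) (α β : ℝ) (hα : -1 < α) (hβ : -1 < β) :
    jacAngCoeff r n α β (j + r) * ((j + r).descFactorial r * (j + r + β)) =
      (-1) ^ r * ((n - j).descFactorial r : ℝ) * (r * α + β + r * n + r + j) *
        jacAngCoeff r n α β j := by
  rcases lt_or_ge n (j + r) with h | h
  · rw [jacAngCoeff_eq_zero α β h, Nat.descFactorial_of_lt (show n - j < r by omega)]
    simp
  have hr₀ : (0 : ℝ) < r := by exact_mod_cast hr
  have hn : (1 : ℝ) ≤ n := by exact_mod_cast (show 1 ≤ n by omega)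
  have hr₁ : (1 : ℝ) ≤ r := by exact_mod_cast hr
  have hb : 0 < (β + j) / r + 1 := by
    rw [div_add_one hr₀.ne']
    have : (0 : ℝ) ≤ j := j.cast_nonneg
    exact div_pos (by linarith) hr₀
  have ht : 0 < n + α + (β + j) / r + 1 := by linarith
  have hshift : (β + (j + r : ℕ)) / r = (β + j) / r + 1 := by
    push_cast; field_simp; ring
  have hsign : (-1 : ℝ) ^ (n - j) = (-1) ^ (n - (j + r)) * (-1) ^ r := by
    rw [← pow_add]; congr 1; omega
  have hsq : ((-1 : ℝ) ^ r) * (-1) ^ r = 1 := by rw [← mul_pow]; norm_num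
  have hch : (n.choose (j + r) : ℝ) * (j + r).descFactorial r =
      n.choose j * (n - j).descFactorial r := by
    exact_mod_cast choose_add_mul_descFactorial n j r
  have hG := (Real.Gamma_pos_of_pos hb).ne'
  have hj : ((j : ℝ) + r + β) = r * ((β + j) / r + 1) := by field_simp; ring
  have hs : ((r : ℝ) * α + β + r * n + r + j) = r * (n + α + (β + j) / r + 1) := by
    field_simp; ring
  rw [jacAngCoeff, jacAngCoeff, hshift, ← add_assoc (n + α : ℝ), Real.Gamma_add_one ht.ne',
    Real.Gamma_add_one hb.ne', hsign, hj, hs]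
  generalize (β + j) / (r : ℝ) + 1 = b at *
  generalize (n + α + (β + j) / (r : ℝ) + 1) = t at *
  have hfrac : t * Real.Gamma t / (Real.Gamma (n + α + 1) * (b * Real.Gamma b)) * (r * b) =
      r * t * (Real.Gamma t / (Real.Gamma (n + α + 1) * Real.Gamma b)) := by
    have := hb.ne'
    rw [div_mul_eq_mul_div, mul_div_assoc', mul_left_comm (Real.Gamma _) b,
      show t * Real.Gamma t * (r * b) = b * (r * t * Real.Gamma t) by ring,
      mul_div_mul_left _ _ this]
  generalize Real.Gamma t / (Real.Gamma (n + α + 1) * Real.Gamma b) = u at *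
  generalize t * Real.Gamma t / (Real.Gamma (n + α + 1) * (b * Real.Gamma b)) = v at *
  linear_combination
    (n.choose (j + r) : ℝ) * (j + r).descFactorial r * (-1) ^ (n - (j + r)) * hfrac +
    r * t * u * (-1) ^ (n - (j + r)) * hch -
    r * t * u * (-1) ^ (n - (j + r)) * n.choose j * (n - j).descFactorial r * hsq

lemma pow_mul_descFactorial_mul_pow (x : ℝ) (j k : ℕ) :
    x ^ k * (j.descFactorial k * x ^ (j - k)) = j.descFactorial k * x ^ j := by
  rcases lt_or_ge j k with h | h
  · simp [Nat.descFactorial_of_lt h]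
  · rw [mul_left_comm, ← pow_add, Nat.add_sub_cancel' h]

lemma mul_descFactorial_succ_mul_pow (x : ℝ) (j r : ℕ) :
    x * (j.descFactorial (r + 1) * x ^ (j - (r + 1))) =
      (j.descFactorial r : ℝ) * (j - r) * x ^ (j - r) := by
  rcases lt_trichotomy j r with h | rfl | h
  · simp [Nat.descFactorial_of_lt h]
  · simp
  · rw [Nat.descFactorial_succ, Nat.cast_mul, Nat.cast_sub h.le,
      show j - r = (j - (r + 1)) + 1 by omega, pow_succ]
    ring

lemma sum_jacAngCoeff_shift (r n : ℕ) (α β x : ℝ) :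
    ∑ j ∈ Finset.range (n + 1),
      jacAngCoeff r n α β j * ((j.descFactorial r : ℝ) * (j + β)) * x ^ (j - r) =
    ∑ j ∈ Finset.range (n + 1),
      jacAngCoeff r n α β (j + r) * (((j + r).descFactorial r : ℝ) * (j + r + β)) * x ^ j := by
  set f : ℕ → ℝ := fun j ↦
    jacAngCoeff r n α β j * ((j.descFactorial r : ℝ) * (j + β)) * x ^ (j - r) with hf
  have h₁ : ∑ j ∈ Finset.range (n + 1 + r), f j = ∑ j ∈ Finset.range (n + 1), f j := by
    rw [Finset.sum_range_add, add_eq_left]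
    exact Finset.sum_eq_zero fun i _ ↦ by
      simp [hf, jacAngCoeff_eq_zero α β (show n < n + 1 + i by omega)]
  rw [← h₁, add_comm (n + 1) r, Finset.sum_range_add, Finset.sum_eq_zero, zero_add]
  · refine Finset.sum_congr rfl fun j _ ↦ ?_
    simp [hf, add_comm r j]
  · intro i hi
    simp [hf, Nat.descFactorial_of_lt (Finset.mem_range.mp hi)]

/-- y = p_n(x; α, β) satisfies the order r+1 linear ODE
x(1−x^r) y^{(r+1)} + (r+β) y^{(r)} + ∑_{k=0}^r c_{k,n}^{(α,β)} x^k y^{(k)} = 0. -/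
theorem jacAng_higher_order_ode
    (r : ℕ) (hr : 1 ≤ r) (α β : ℝ) (hα : -1 < α) (hβ : -1 < β) (n : ℕ) (x : ℝ) :
    x * (1 - x ^ r) * iteratedDeriv (r + 1) (jacAng r n α β) x
      + ((r : ℝ) + β) * iteratedDeriv r (jacAng r n α β) x
      + ∑ k ∈ Finset.range (r + 1),
          odeCoeff r k n α β * x ^ k * iteratedDeriv k (jacAng r n α β) x = 0 := by
  simp only [iteratedDeriv_jacAng, Finset.mul_sum]
  rw [Finset.sum_comm, ← Finset.sum_add_distrib, ← Finset.sum_add_distrib]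
  have hterm : ∀ j ∈ Finset.range (n + 1),
      x * (1 - x ^ r) * (jacAngCoeff r n α β j *
          ((j.descFactorial (r + 1) : ℝ) * x ^ (j - (r + 1)))) +
        ((r : ℝ) + β) * (jacAngCoeff r n α β j * ((j.descFactorial r : ℝ) * x ^ (j - r))) +
        ∑ k ∈ Finset.range (r + 1), odeCoeff r k n α β * x ^ k *
          (jacAngCoeff r n α β j * ((j.descFactorial k : ℝ) * x ^ (j - k))) =
      jacAngCoeff r n α β j * ((j.descFactorial r : ℝ) * (j + β)) * x ^ (j - r) -
        (-1) ^ r * ((n - j).descFactorial r : ℝ) * (r * α + β + r * n + r + j) *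
          jacAngCoeff r n α β j * x ^ j := by
    intro j hj
    have hQ := sum_odeCoeff_mul_descFactorial r n j
      (Nat.lt_succ_iff.mp (Finset.mem_range.mp hj)) α β
    have hsum : ∑ k ∈ Finset.range (r + 1), odeCoeff r k n α β * x ^ k *
          (jacAngCoeff r n α β j * ((j.descFactorial k : ℝ) * x ^ (j - k))) =
        (∑ k ∈ Finset.range (r + 1), odeCoeff r k n α β * (j.descFactorial k : ℝ)) *
          (jacAngCoeff r n α β j * x ^ j) := by
      rw [Finset.sum_mul]
      refine Finset.sum_congr rfl fun k _ ↦ ?_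
      linear_combination odeCoeff r k n α β * jacAngCoeff r n α β j *
        pow_mul_descFactorial_mul_pow x j k
    rw [hsum]
    linear_combination jacAngCoeff r n α β j * x ^ j * hQ +
      jacAngCoeff r n α β j * mul_descFactorial_succ_mul_pow x j r -
      jacAngCoeff r n α β j * pow_mul_descFactorial_mul_pow x j (r + 1)
  rw [Finset.sum_congr rfl hterm, Finset.sum_sub_distrib, sum_jacAngCoeff_shift,
    ← Finset.sum_sub_distrib]
  refine Finset.sum_eq_zero fun j _ ↦ ?_
  rw [jacAngCoeff_add r n j hr α β hα hβ, sub_self]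
end

section
/- Let r ≥ 1 be an integer, α, β > −1 real, and n ≥ 1 an integer. Then the polynomial p_n(x; α, β), viewed as a polynomial over ℂ, has exactly n roots; all of them are real, simple, and lie in the open interval (0,1). -/
/-- The polynomial p_n(x; α, β) on the r-star, as a polynomial over ℂ. -/
noncomputable def jacAngPolyC (r n : ℕ) (α β : ℝ) : Polynomial ℂ :=
  ∑ k ∈ Finset.range (n + 1),
    Polynomial.C ((n.choose k : ℂ) *
      ((Real.Gamma (n + α + (β + k) / r + 1) /
        (Real.Gamma (n + α + 1) * Real.Gamma ((β + k) / r + 1)) : ℝ) : ℂ) *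
      (-1) ^ (n - k)) * Polynomial.X ^ k

open MeasureTheory in
lemma betaIntegrand_integrableOn_Ioo {a b : ℝ} (ha : -1 < a) (hb : -1 < b) :
    IntegrableOn (fun t : ℝ => t ^ a * (1 - t) ^ b) (Set.Ioo 0 1) := by
  have h := Complex.betaIntegral_convergent (u := ((a + 1 : ℝ) : ℂ)) (v := ((b + 1 : ℝ) : ℂ))
    (by rw [Complex.ofReal_re]; linarith) (by rw [Complex.ofReal_re]; linarith)
  rw [intervalIntegrable_iff_integrableOn_Ioo_of_le zero_le_one] at h
  refine (integrableOn_congr_fun (fun t ht => ?_) measurableSet_Ioo).mp h.re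
  obtain ⟨h0, h1⟩ := ht
  have e1 : ((a + 1 : ℝ) : ℂ) - 1 = (a : ℂ) := by push_cast; ring
  have e2 : ((b + 1 : ℝ) : ℂ) - 1 = (b : ℂ) := by push_cast; ring
  have e3 : (1 : ℂ) - (t : ℂ) = ((1 - t : ℝ) : ℂ) := by push_cast; ring
  simp only [e1, e2, e3]
  rw [← Complex.ofReal_cpow h0.le, ← Complex.ofReal_cpow (by linarith), ← Complex.ofReal_mul]
  exact Complex.ofReal_re _

open MeasureTheory in
lemma setIntegral_Ioo_rpow_mul_one_sub_rpow {a b : ℝ} (ha : -1 < a) (hb : -1 < b) :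
    ∫ t in Set.Ioo (0 : ℝ) 1, t ^ a * (1 - t) ^ b =
      Real.Gamma (a + 1) * Real.Gamma (b + 1) / Real.Gamma (a + b + 2) := by
  have h := Complex.betaIntegral_eq_Gamma_mul_div ((a + 1 : ℝ) : ℂ) ((b + 1 : ℝ) : ℂ)
    (by rw [Complex.ofReal_re]; linarith) (by rw [Complex.ofReal_re]; linarith)
  rw [Complex.betaIntegral, intervalIntegral.integral_of_le zero_le_one,
    integral_Ioc_eq_integral_Ioo, ← Complex.ofReal_add, Complex.Gamma_ofReal, Complex.Gamma_ofReal,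
    Complex.Gamma_ofReal] at h
  have e : ∫ t in Set.Ioo (0 : ℝ) 1, (t : ℂ) ^ (((a + 1 : ℝ) : ℂ) - 1) *
      (1 - (t : ℂ)) ^ (((b + 1 : ℝ) : ℂ) - 1) =
      ∫ t in Set.Ioo (0 : ℝ) 1, ((t ^ a * (1 - t) ^ b : ℝ) : ℂ) := by
    refine setIntegral_congr_fun measurableSet_Ioo fun t ht => ?_
    obtain ⟨h0, h1⟩ := ht
    have e1 : ((a + 1 : ℝ) : ℂ) - 1 = (a : ℂ) := by push_cast; ring
    have e2 : ((b + 1 : ℝ) : ℂ) - 1 = (b : ℂ) := by push_cast; ring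
    have e3 : (1 : ℂ) - (t : ℂ) = ((1 - t : ℝ) : ℂ) := by push_cast; ring
    simp only [e1, e2, e3]
    rw [← Complex.ofReal_cpow h0.le, ← Complex.ofReal_cpow (by linarith), ← Complex.ofReal_mul]
  rw [e, integral_complex_ofReal] at h
  have h' : ∫ t in Set.Ioo (0 : ℝ) 1, t ^ a * (1 - t) ^ b =
      Real.Gamma (a + 1) * Real.Gamma (b + 1) / Real.Gamma (a + 1 + (b + 1)) := by
    exact_mod_cast h
  rw [h']
  ring_nf

lemma Real.Gamma_add_natCast_eq_ascPochhammer_eval_mul {x : ℝ} (hx : 0 < x) (m : ℕ) :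
    Real.Gamma (x + m) = (ascPochhammer ℝ m).eval x * Real.Gamma x := by
  induction m with
  | zero => simp
  | succ m ih =>
    have : x + (m + 1 : ℕ) = (x + m) + 1 := by push_cast; ring
    rw [this, Real.Gamma_add_one (by positivity), ih, ascPochhammer_succ_eval]
    ring

lemma Polynomial.sum_choose_mul_neg_one_pow_mul_eval_eq_zero {F : Polynomial ℝ} {n : ℕ}
    (hF : F.natDegree < n) :
    ∑ k ∈ Finset.range (n + 1), (n.choose k : ℝ) * (-1) ^ (n - k) * F.eval (k : ℝ) = 0 := by
  have h := congrFun (Polynomial.fwdDiff_iter_eq_zero_of_degree_lt hF) 0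
  rw [fwdDiff_iter_eq_sum_shift] at h
  refine Eq.trans (Finset.sum_congr rfl fun k _ => ?_) h
  simp only [zsmul_eq_mul, nsmul_eq_mul, mul_one, zero_add]
  push_cast
  ring

/-- The real polynomial underlying `jacAngPolyC`. -/
noncomputable def jacAngPoly (r n : ℕ) (α β : ℝ) : Polynomial ℝ :=
  ∑ k ∈ Finset.range (n + 1), Polynomial.C (jacAngCoeff r n α β k) * Polynomial.X ^ k

lemma jacAngPolyC_eq_map (r n : ℕ) (α β : ℝ) :
    jacAngPolyC r n α β = (jacAngPoly r n α β).map Complex.ofRealHom := by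
  simp only [jacAngPolyC, jacAngPoly, jacAngCoeff, Polynomial.map_sum, Polynomial.map_mul,
    Polynomial.map_pow, Polynomial.map_X, Polynomial.map_C, Complex.ofRealHom_eq_coe]
  refine Finset.sum_congr rfl fun k _ => ?_
  push_cast
  rfl

lemma neg_one_lt_add_natCast_div {r : ℕ} (hr : 1 ≤ r) {β : ℝ} (hβ : -1 < β) (k : ℕ) :
    -1 < (β + k) / r := by
  have hr' : (1 : ℝ) ≤ r := by exact_mod_cast hr
  have hk : (0 : ℝ) ≤ k := k.cast_nonneg
  rw [lt_div_iff₀ (by linarith)]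
  linarith

lemma natDegree_jacAngPoly_le (r n : ℕ) (α β : ℝ) : (jacAngPoly r n α β).natDegree ≤ n :=
  Polynomial.natDegree_sum_le_of_forall_le _ _ fun _ hk =>
    (Polynomial.natDegree_C_mul_X_pow_le _ _).trans (Finset.mem_range_succ_iff.mp hk)

lemma jacAngPoly_ne_zero {r : ℕ} (hr : 1 ≤ r) {α β : ℝ} (hα : -1 < α) (hβ : -1 < β)
    {n : ℕ} (hn : 1 ≤ n) : jacAngPoly r n α β ≠ 0 := by
  intro h
  have hc : (jacAngPoly r n α β).coeff n = jacAngCoeff r n α β n := by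
    simp [jacAngPoly, Polynomial.finsetSum_coeff, Polynomial.coeff_X_pow]
  have hs := neg_one_lt_add_natCast_div hr hβ n
  have hn' : (1 : ℝ) ≤ n := by exact_mod_cast hn
  have h1 := Real.Gamma_pos_of_pos (show 0 < n + α + (β + n) / r + 1 by linarith)
  have h2 := Real.Gamma_pos_of_pos (show 0 < n + α + 1 by linarith)
  have h3 := Real.Gamma_pos_of_pos (show 0 < (β + n) / r + 1 by linarith)
  have : 0 < jacAngCoeff r n α β n := by
    simp only [jacAngCoeff, Nat.choose_self, Nat.cast_one, Nat.sub_self, pow_zero]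
    positivity
  rw [h, Polynomial.coeff_zero] at hc
  linarith

/-- The `j`-th moment of `jacAngPoly` in the variable `t = x ^ r` vanishes for `j < n`. -/
lemma sum_jacAngCoeff_mul_beta_eq_zero {r : ℕ} (hr : 1 ≤ r) {α β : ℝ} (hα : -1 < α) (hβ : -1 < β)
    {n j : ℕ} (hj : j < n) :
    ∑ k ∈ Finset.range (n + 1), jacAngCoeff r n α β k *
      (Real.Gamma ((β + k) / r + j + 1) * Real.Gamma (α + 1) /
        Real.Gamma ((β + k) / r + j + α + 2)) = 0 := by
  obtain ⟨m, rfl⟩ : ∃ m, n = j + m + 1 := Nat.exists_eq_add_of_lt hj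
  let L : ℝ → Polynomial ℝ := fun c =>
    Polynomial.C (1 / (r : ℝ)) * Polynomial.X + Polynomial.C (β / r + c)
  have hL : ∀ c, (L c).natDegree ≤ 1 := fun c => Polynomial.natDegree_linear_le
  have hLe : ∀ c (k : ℕ), (L c).eval (k : ℝ) = (β + k) / r + c := fun c k => by
    simp only [L, Polynomial.eval_add, Polynomial.eval_mul, Polynomial.eval_C, Polynomial.eval_X]
    ring
  let F : Polynomial ℝ := (ascPochhammer ℝ j).comp (L 1) * (ascPochhammer ℝ m).comp (L (j + α + 2))
  have hF : F.natDegree < j + m + 1 := by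
    have h1 : ∀ i c, ((ascPochhammer ℝ i).comp (L c)).natDegree ≤ i := fun i c => by
      refine Polynomial.natDegree_comp_le.trans ?_
      rw [ascPochhammer_natDegree]
      exact (Nat.mul_le_mul_left i (hL c)).trans (by simp)
    exact Nat.lt_succ_of_le (Polynomial.natDegree_mul_le.trans (add_le_add (h1 _ _) (h1 _ _)))
  have h0 := Polynomial.sum_choose_mul_neg_one_pow_mul_eval_eq_zero hF
  rw [← mul_zero (Real.Gamma (α + 1) / Real.Gamma ((j + m + 1 : ℕ) + α + 1)), ← h0, Finset.mul_sum]
  refine Finset.sum_congr rfl fun k _ => ?_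
  have hs := neg_one_lt_add_natCast_div hr hβ k
  have hj0 : (0 : ℝ) ≤ j := j.cast_nonneg
  have hm0 : (0 : ℝ) ≤ m := m.cast_nonneg
  have g1 := Real.Gamma_add_natCast_eq_ascPochhammer_eval_mul
    (show 0 < (β + k) / r + 1 by linarith) j
  have g2 := Real.Gamma_add_natCast_eq_ascPochhammer_eval_mul
    (show 0 < (β + k) / r + (j + α + 2) by linarith) m
  have p1 := Real.Gamma_pos_of_pos (show 0 < (β + k) / r + 1 by linarith)
  have p2 := Real.Gamma_pos_of_pos (show 0 < (β + k) / r + (j + α + 2) by linarith)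
  have p3 := Real.Gamma_pos_of_pos (show 0 < ((j + m + 1 : ℕ) : ℝ) + α + 1 by push_cast; linarith)
  simp only [F, Polynomial.eval_mul, Polynomial.eval_comp, hLe, jacAngCoeff]
  rw [show ((j + m + 1 : ℕ) : ℝ) + α + (β + k) / r + 1 = (β + k) / r + (j + α + 2) + m by
      push_cast; ring, g2, show (β + k) / r + j + 1 = (β + k) / r + 1 + j by ring, g1,
    show (β + k) / r + j + α + 2 = (β + k) / r + (j + α + 2) by ring]
  generalize Real.Gamma ((β + k) / r + 1) = A at *
  generalize Real.Gamma ((β + k) / r + (j + α + 2)) = B at *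
  field_simp

lemma jacAngWeight_mul_eq_sum (r n : ℕ) (α β : ℝ) (j : ℕ) {t : ℝ}
    (ht : 0 < t) :
    t ^ (β / r) * (1 - t) ^ α * (jacAngPoly r n α β).eval (t ^ (1 / (r : ℝ))) * t ^ j =
      ∑ k ∈ Finset.range (n + 1),
        jacAngCoeff r n α β k * (t ^ ((β + k) / r + j) * (1 - t) ^ α) := by
  simp only [jacAngPoly, Polynomial.eval_finsetSum, Polynomial.eval_mul, Polynomial.eval_C,
    Polynomial.eval_pow, Polynomial.eval_X, Finset.mul_sum, Finset.sum_mul]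
  refine Finset.sum_congr rfl fun k _ => ?_
  rw [← Real.rpow_mul_natCast ht.le, Real.rpow_add ht, Real.rpow_natCast, add_div,
    Real.rpow_add ht, show 1 / (r : ℝ) * k = k / r by ring]
  ring

lemma jacAngCoeff_exponent_lt {r : ℕ} (hr : 1 ≤ r) {β : ℝ} (hβ : -1 < β) (j k : ℕ) :
    -1 < (β + k) / r + j := by
  have := neg_one_lt_add_natCast_div hr hβ k
  have hj : (0 : ℝ) ≤ j := j.cast_nonneg
  linarith

open MeasureTheory in
lemma integrableOn_jacAngWeight_mul_pow {r : ℕ} (hr : 1 ≤ r) {α β : ℝ} (hα : -1 < α) (hβ : -1 < β)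
    (n j : ℕ) :
    IntegrableOn (fun t : ℝ => t ^ (β / r) * (1 - t) ^ α *
      (jacAngPoly r n α β).eval (t ^ (1 / (r : ℝ))) * t ^ j) (Set.Ioo 0 1) := by
  refine (integrableOn_congr_fun (fun t ht => jacAngWeight_mul_eq_sum r n α β j ht.1)
    measurableSet_Ioo).mpr ?_
  exact integrable_finsetSum _ fun k _ =>
    (betaIntegrand_integrableOn_Ioo (jacAngCoeff_exponent_lt hr hβ j k) hα).const_mul _

open MeasureTheory in
lemma setIntegral_jacAngWeight_mul_pow {r : ℕ} (hr : 1 ≤ r) {α β : ℝ} (hα : -1 < α) (hβ : -1 < β)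
    {n j : ℕ} (hj : j < n) :
    ∫ t in Set.Ioo (0 : ℝ) 1, t ^ (β / r) * (1 - t) ^ α *
      (jacAngPoly r n α β).eval (t ^ (1 / (r : ℝ))) * t ^ j = 0 := by
  rw [setIntegral_congr_fun measurableSet_Ioo
      (fun t ht => jacAngWeight_mul_eq_sum r n α β j ht.1),
    integral_finsetSum _ fun k _ =>
      (betaIntegrand_integrableOn_Ioo (jacAngCoeff_exponent_lt hr hβ j k) hα).const_mul _]
  refine Eq.trans (Finset.sum_congr rfl fun k _ => ?_)
    (sum_jacAngCoeff_mul_beta_eq_zero hr hα hβ hj)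
  rw [integral_const_mul,
    setIntegral_Ioo_rpow_mul_one_sub_rpow (jacAngCoeff_exponent_lt hr hβ j k) hα]

open MeasureTheory in
lemma jacAngPoly_orthogonal {r : ℕ} (hr : 1 ≤ r) {α β : ℝ} (hα : -1 < α) (hβ : -1 < β)
    {n : ℕ} {Q : Polynomial ℝ} (hQ : Q.natDegree < n) :
    IntegrableOn (fun t : ℝ => t ^ (β / r) * (1 - t) ^ α *
      (jacAngPoly r n α β).eval (t ^ (1 / (r : ℝ))) * Q.eval t) (Set.Ioo 0 1) ∧
    ∫ t in Set.Ioo (0 : ℝ) 1, t ^ (β / r) * (1 - t) ^ α *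
      (jacAngPoly r n α β).eval (t ^ (1 / (r : ℝ))) * Q.eval t = 0 := by
  have e : (fun t : ℝ => t ^ (β / r) * (1 - t) ^ α *
      (jacAngPoly r n α β).eval (t ^ (1 / (r : ℝ))) * Q.eval t) = fun t =>
      ∑ i ∈ Finset.range n, Q.coeff i * (t ^ (β / r) * (1 - t) ^ α *
        (jacAngPoly r n α β).eval (t ^ (1 / (r : ℝ))) * t ^ i) := by
    funext t
    rw [Polynomial.eval_eq_sum_range' hQ, Finset.mul_sum]
    exact Finset.sum_congr rfl fun i _ => by ring
  have hi : ∀ i ∈ Finset.range n, IntegrableOn (fun t : ℝ => Q.coeff i * (t ^ (β / r) *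
      (1 - t) ^ α * (jacAngPoly r n α β).eval (t ^ (1 / (r : ℝ))) * t ^ i)) (Set.Ioo 0 1) :=
    fun i _ => (integrableOn_jacAngWeight_mul_pow hr hα hβ n i).const_mul _
  rw [e]
  refine ⟨integrable_finsetSum _ hi, ?_⟩
  rw [integral_finsetSum _ hi]
  refine Finset.sum_eq_zero fun i hin => ?_
  rw [integral_const_mul, setIntegral_jacAngWeight_mul_pow hr hα hβ (Finset.mem_range.mp hin),
    mul_zero]

/-- A nonzero real polynomial can be given constant sign on `(0, 1)` by multiplying it with
distinct linear factors vanishing at some of its roots in `(0, 1)`. -/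
lemma Polynomial.exists_finset_roots_mul_prod_constant_sign {P : Polynomial ℝ} (hP : P ≠ 0) :
    ∃ S : Finset ℝ, (∀ ρ ∈ S, P.IsRoot ρ ∧ ρ ∈ Set.Ioo (0 : ℝ) 1) ∧ ∃ ε : ℝ, ε ≠ 0 ∧
      ∀ x ∈ Set.Ioo (0 : ℝ) 1, 0 ≤ ε * (P.eval x * ∏ ρ ∈ S, (x - ρ)) := by
  induction hd : P.natDegree using Nat.strong_induction_on generalizing P with
  | _ d ih =>
  by_cases hroot : ∃ a ∈ Set.Ioo (0 : ℝ) 1, P.IsRoot a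
  · obtain ⟨a, ha, hPa⟩ := hroot
    obtain ⟨P', rfl⟩ := Polynomial.dvd_iff_isRoot.mpr hPa
    have hP' : P' ≠ 0 := right_ne_zero_of_mul hP
    have hlt : P'.natDegree < d := by
      rw [← hd, Polynomial.natDegree_mul (Polynomial.X_sub_C_ne_zero a) hP',
        Polynomial.natDegree_X_sub_C]
      omega
    obtain ⟨S, hS, ε, hε, hsign⟩ := ih _ hlt hP' rfl
    have hS' : ∀ ρ ∈ S, ((Polynomial.X - Polynomial.C a) * P').IsRoot ρ ∧
        ρ ∈ Set.Ioo (0 : ℝ) 1 := fun ρ hρ =>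
      ⟨Polynomial.root_mul_left_of_isRoot _ (hS ρ hρ).1, (hS ρ hρ).2⟩
    by_cases haS : a ∈ S
    · refine ⟨S.erase a, fun ρ hρ => hS' ρ (Finset.mem_of_mem_erase hρ), ε, hε, fun x hx => ?_⟩
      have h := hsign x hx
      rw [← Finset.mul_prod_erase S _ haS] at h
      simp only [Polynomial.eval_mul, Polynomial.eval_sub, Polynomial.eval_X, Polynomial.eval_C]
      linarith
    · refine ⟨insert a S, fun ρ hρ => ?_, ε, hε, fun x hx => ?_⟩
      · rcases Finset.mem_insert.mp hρ with rfl | hρ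
        · exact ⟨hPa, ha⟩
        · exact hS' ρ hρ
      · have h := mul_nonneg (sq_nonneg (x - a)) (hsign x hx)
        rw [Finset.prod_insert haS]
        simp only [Polynomial.eval_mul, Polynomial.eval_sub, Polynomial.eval_X, Polynomial.eval_C]
        linarith
  · push Not at hroot
    have hhalf : (1 / 2 : ℝ) ∈ Set.Ioo (0 : ℝ) 1 := by constructor <;> norm_num
    refine ⟨∅, by simp, P.eval (1 / 2), hroot _ hhalf, fun x hx => ?_⟩
    rw [Finset.prod_empty, mul_one]
    by_contra! hneg
    have hpre := (isPreconnected_Ioo (a := (0 : ℝ)) (b := 1)).image _ P.continuous.continuousOn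
    have h1 := Set.mem_image_of_mem (fun y => P.eval y) hhalf
    have h2 := Set.mem_image_of_mem (fun y => P.eval y) hx
    have h0 : (0 : ℝ) ∈ (fun y => P.eval y) '' Set.Ioo (0 : ℝ) 1 := by
      rcases mul_neg_iff.mp hneg with ⟨hp, hq⟩ | ⟨hp, hq⟩
      · exact hpre.ordConnected.out h2 h1 ⟨hq.le, hp.le⟩
      · exact hpre.ordConnected.out h1 h2 ⟨hp.le, hq.le⟩
    obtain ⟨y, hy, hy0⟩ := h0
    exact hroot y hy hy0

lemma sub_mul_pow_sub_pow_nonneg {x ρ : ℝ} (hx : 0 ≤ x) (hρ : 0 ≤ ρ) (r : ℕ) :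
    0 ≤ (x - ρ) * (x ^ r - ρ ^ r) := by
  rcases le_total x ρ with h | h
  · exact mul_nonneg_of_nonpos_of_nonpos (by linarith) (by linarith [pow_le_pow_left₀ hx h r])
  · exact mul_nonneg (by linarith) (by linarith [pow_le_pow_left₀ hρ h r])

open MeasureTheory in
lemma exists_finset_roots_jacAngPoly {r : ℕ} (hr : 1 ≤ r) {α β : ℝ} (hα : -1 < α) (hβ : -1 < β)
    {n : ℕ} (hn : 1 ≤ n) :
    ∃ S : Finset ℝ, (∀ ρ ∈ S, (jacAngPoly r n α β).IsRoot ρ ∧ ρ ∈ Set.Ioo (0 : ℝ) 1) ∧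
      n ≤ S.card := by
  have hP0 := jacAngPoly_ne_zero hr hα hβ hn
  obtain ⟨S, hS, ε, hε, hsign⟩ := Polynomial.exists_finset_roots_mul_prod_constant_sign hP0
  refine ⟨S, hS, ?_⟩
  by_contra! hlt
  let Q : Polynomial ℝ := ∏ ρ ∈ S, (Polynomial.X - Polynomial.C (ρ ^ r))
  have hQeval : ∀ t, Q.eval t = ∏ ρ ∈ S, (t - ρ ^ r) := fun t => by
    simp [Q, Polynomial.eval_prod]
  have hQdeg : Q.natDegree < n := by
    rwa [Polynomial.natDegree_finsetProd_X_sub_C_eq_card]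
  have hr0 : (r : ℝ) ≠ 0 := by exact_mod_cast (by omega : r ≠ 0)
  have hroot : ∀ t ∈ Set.Ioo (0 : ℝ) 1, t ^ (1 / (r : ℝ)) ∈ Set.Ioo (0 : ℝ) 1 ∧
      (t ^ (1 / (r : ℝ))) ^ r = t := fun t ht => by
    refine ⟨⟨Real.rpow_pos_of_pos ht.1 _, Real.rpow_lt_one ht.1.le ht.2 (by positivity)⟩, ?_⟩
    rw [← Real.rpow_mul_natCast ht.1.le, one_div_mul_cancel hr0, Real.rpow_one]
  obtain ⟨hint, hzero⟩ := jacAngPoly_orthogonal hr hα hβ hQdeg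
  have hnonneg : ∀ t ∈ Set.Ioo (0 : ℝ) 1, 0 ≤ ε * (t ^ (β / r) * (1 - t) ^ α *
      (jacAngPoly r n α β).eval (t ^ (1 / (r : ℝ))) * Q.eval t) := fun t ht => by
    obtain ⟨hx, hxr⟩ := hroot t ht
    set x := t ^ (1 / (r : ℝ))
    have hw : 0 ≤ t ^ (β / r) * (1 - t) ^ α :=
      mul_nonneg (Real.rpow_nonneg ht.1.le _) (Real.rpow_nonneg (by linarith [ht.2]) _)
    suffices h : 0 ≤ ε * ((jacAngPoly r n α β).eval x * Q.eval t) by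
      linarith [mul_nonneg hw h]
    have hprod : 0 ≤ (∏ ρ ∈ S, (x - ρ)) * Q.eval t := by
      rw [hQeval, ← Finset.prod_mul_distrib]
      refine Finset.prod_nonneg fun ρ hρ => ?_
      rw [← hxr]
      exact sub_mul_pow_sub_pow_nonneg hx.1.le (hS ρ hρ).2.1.le r
    by_cases hp : ∏ ρ ∈ S, (x - ρ) = 0
    · obtain ⟨ρ, hρ, hxρ⟩ := Finset.prod_eq_zero_iff.mp hp
      rw [sub_eq_zero.mp hxρ, (hS ρ hρ).1.eq_zero, zero_mul, mul_zero]
    · have h := mul_nonneg (hsign x hx) hprod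
      refine nonneg_of_mul_nonneg_left ?_ (sq_pos_of_ne_zero hp)
      linarith
  have hae := (setIntegral_eq_zero_iff_of_nonneg_ae
    (ae_restrict_of_forall_mem measurableSet_Ioo hnonneg) (hint.const_mul ε)).mp
    (by rw [integral_const_mul, hzero, mul_zero])
  let Z : Set ℝ := ((fun x : ℝ => x ^ r) '' {x | (jacAngPoly r n α β).IsRoot x}) ∪
    {t | Q.IsRoot t}
  have hQ0 : Q ≠ 0 := Finset.prod_ne_zero_iff.mpr fun ρ _ => Polynomial.X_sub_C_ne_zero _
  have hZ : Z.Finite :=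
    ((Polynomial.finite_setOfPred_isRoot hP0).image _).union (Polynomial.finite_setOfPred_isRoot hQ0)
  have hmem : ∀ᵐ t ∂volume, t ∈ Set.Ioo (0 : ℝ) 1 → t ∈ Z := by
    filter_upwards [(ae_restrict_iff' measurableSet_Ioo).mp hae] with t ht hmem
    obtain ⟨hx, hxr⟩ := hroot t hmem
    have h := ht hmem
    have hw1 := (Real.rpow_pos_of_pos hmem.1 (β / r)).ne'
    have hw2 := (Real.rpow_pos_of_pos (sub_pos.mpr hmem.2) α).ne'
    simp only [Pi.zero_apply, mul_eq_zero, hε, hw1, hw2, false_or] at h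
    exact h.imp (fun h => ⟨_, h, hxr⟩) id
  have hnull : volume (Set.Ioo (0 : ℝ) 1) = 0 := by
    have h1 : Set.Ioo (0 : ℝ) 1 ≤ᵐ[volume] Z := hmem
    exact le_antisymm ((measure_mono_ae h1).trans (hZ.measure_zero _).le) zero_le
  simp at hnull

/-- for r ≥ 1, α, β > −1 and n ≥ 1, the polynomial p_n(x; α, β), viewed over ℂ,
has exactly n roots, all real, simple, and lying in the open interval (0,1). -/
theorem jacAngPolyC_roots_real_simple_in_Ioo
    (r : ℕ) (hr : 1 ≤ r) (α β : ℝ) (hα : -1 < α) (hβ : -1 < β) (n : ℕ) (hn : 1 ≤ n) :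
    Multiset.card (jacAngPolyC r n α β).roots = n ∧
    (jacAngPolyC r n α β).roots.Nodup ∧
    ∀ z ∈ (jacAngPolyC r n α β).roots, z.im = 0 ∧ z.re ∈ Set.Ioo (0:ℝ) 1 := by
  have hP0 : jacAngPolyC r n α β ≠ 0 := by
    rw [jacAngPolyC_eq_map]
    exact (Polynomial.map_ne_zero_iff Complex.ofRealHom.injective).mpr
      (jacAngPoly_ne_zero hr hα hβ hn)
  have hdeg : (jacAngPolyC r n α β).natDegree ≤ n := by
    rw [jacAngPolyC_eq_map]
    exact Polynomial.natDegree_map_le.trans (natDegree_jacAngPoly_le r n α β)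
  obtain ⟨S, hS, hcard⟩ := exists_finset_roots_jacAngPoly hr hα hβ hn
  have hnodup : (S.val.map Complex.ofReal).Nodup := S.nodup.map Complex.ofReal_injective
  have hle : S.val.map Complex.ofReal ≤ (jacAngPolyC r n α β).roots := by
    refine (Multiset.le_iff_subset hnodup).mpr fun z hz => ?_
    obtain ⟨ρ, hρ, rfl⟩ := Multiset.mem_map.mp hz
    rw [Polynomial.mem_roots hP0, jacAngPolyC_eq_map]
    exact (hS ρ hρ).1.map (f := Complex.ofRealHom)
  have hcard' : Multiset.card (jacAngPolyC r n α β).roots ≤ n :=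
    (Polynomial.card_roots' _).trans hdeg
  have heq : S.val.map Complex.ofReal = (jacAngPolyC r n α β).roots :=
    Multiset.eq_of_le_of_card_le hle (by rw [Multiset.card_map]; exact hcard'.trans hcard)
  refine ⟨le_antisymm hcard' ?_, heq ▸ hnodup, fun z hz => ?_⟩
  · rw [← heq, Multiset.card_map]
    exact hcard
  · rw [← heq] at hz
    obtain ⟨ρ, hρ, rfl⟩ := Multiset.mem_map.mp hz
    exact ⟨Complex.ofReal_im ρ, (hS ρ hρ).2⟩
end
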